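/- arXiv:2208.13698 — 4 statements merged into one kernel-verified Lean document; each statement's English description precedes it below -/
import Mathlib

section
/- (Parabolic case.) Let γ(t) = Ψ(u(t), v(t)) be a nondegenerate curve on [a,b] with cosh(u(t)) sin(v(t)) − sinh(u(t)) > 0 and cosh(u(t)) sin(v(t)) − sinh(u(t)) + λ ≠ 0 for all t. Then γ is a critical point of the energy with density ρ(u,v) = cosh(u) sin(v) − sinh(u) + λ (a catenary with respect to the degenerate plane {y − z = 0}) if and only if its geodesic curvature satisfies κ(t) = − ( v'(t) cosh(u(t)) (sinh(u(t)) sin(v(t)) − cosh(u(t))) + u'(t) cos(v(t)) ) / ( (cosh(u(t)) sin(v(t)) − sinh(u(t)) + λ) · |γ'(t)| ) for all t ∈ [a,b]. -/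
noncomputable section

open Real

/-- Lorentzian inner product on `ℝ³`: `⟨p,q⟩ = p₁q₁ + p₂q₂ − p₃q₃`. -/
def lprod (p q : Fin 3 → ℝ) : ℝ := p 0 * q 0 + p 1 * q 1 - p 2 * q 2

/-- Determinant of the 3×3 matrix with rows `a`, `b`, `c`. -/
def det3 (a b c : Fin 3 → ℝ) : ℝ :=
  a 0 * (b 1 * c 2 - b 2 * c 1) - a 1 * (b 0 * c 2 - b 2 * c 0)
    + a 2 * (b 0 * c 1 - b 1 * c 0)

/-- Parametrization `Ψ` of the de Sitter plane `S₁² ⊂ L³`. -/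
def Psi (u v : ℝ) : Fin 3 → ℝ :=
  ![Real.cosh u * Real.cos v, Real.cosh u * Real.sin v, Real.sinh u]

/-- The curve `t ↦ Ψ(u t, v t)`, restricted to `[a, b]`, is a critical point of the
energy `E[γ] = ∫ₐᵇ ρ(u(t), v(t)) |γ'(t)| dt` among variations fixing the endpoints. -/
def IsCritical (ρ : ℝ → ℝ → ℝ) (ε : ℝ) (u v : ℝ → ℝ) (a b : ℝ) : Prop :=
  ∀ φ ψ : ℝ → ℝ, ContDiff ℝ (⊤ : ℕ∞) φ → ContDiff ℝ (⊤ : ℕ∞) ψ →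
    φ a = 0 → φ b = 0 → ψ a = 0 → ψ b = 0 →
    deriv (fun s : ℝ => ∫ t in a..b,
      ρ (u t + s * φ t) (v t + s * ψ t) *
        Real.sqrt (ε * ((deriv v t + s * deriv ψ t) ^ 2 *
          Real.cosh (u t + s * φ t) ^ 2 - (deriv u t + s * deriv φ t) ^ 2))) 0 = 0

open Set MeasureTheory Topology in
/-- Differentiation under the integral sign over a compact interval, for an integrand that is
continuously differentiable in the parameter on an open neighbourhood of `{x₀} × [a, b]`. -/
theorem hasDerivAt_intervalIntegral_of_continuousOn {a b x₀ : ℝ} (hab : a ≤ b)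
    {F F' : ℝ → ℝ → ℝ} {U : Set (ℝ × ℝ)} (hU : IsOpen U)
    (hx₀ : ∀ t ∈ Icc a b, (x₀, t) ∈ U)
    (hF : Continuous fun p : ℝ × ℝ => F p.1 p.2)
    (hF' : ContinuousOn (fun p : ℝ × ℝ => F' p.1 p.2) U)
    (hd : ∀ p ∈ U, HasDerivAt (fun s => F s p.2) (F' p.1 p.2) p.1) :
    HasDerivAt (fun s => ∫ t in a..b, F s t) (∫ t in a..b, F' x₀ t) x₀ := by
  obtain ⟨V, T, hV, -, hxV, hT, hVT⟩ := generalized_tube_lemma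
    (isCompact_singleton (x := x₀)) (isCompact_Icc (a := a) (b := b)) hU (by
      rintro ⟨x, t⟩ ⟨hx, ht⟩
      obtain rfl : x = x₀ := hx
      exact hx₀ t ht)
  obtain ⟨δ, hδ, hball⟩ := Metric.nhds_basis_closedBall.mem_iff.1
    (hV.mem_nhds (hxV rfl))
  have hsub : Metric.closedBall x₀ δ ×ˢ Icc a b ⊆ U :=
    (prod_mono hball hT).trans hVT
  obtain ⟨C, hC⟩ := ((isCompact_closedBall x₀ δ).prod isCompact_Icc).exists_bound_of_continuousOn
    (hF'.mono hsub)
  have hIoc : ∀ t ∈ uIoc a b, t ∈ Icc a b := fun t ht => by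
    rw [uIoc_of_le hab] at ht
    exact Ioc_subset_Icc_self ht
  have hF'x₀ : ContinuousOn (F' x₀) (Icc a b) :=
    hF'.comp (f := fun t : ℝ => (x₀, t)) (by fun_prop) hx₀
  refine (intervalIntegral.hasDerivAt_integral_of_dominated_loc_of_deriv_le
    (bound := fun _ => C) (Metric.closedBall_mem_nhds x₀ hδ) ?_ ?_ ?_ ?_ (by simp) ?_).2
  · exact .of_forall fun s =>
      (hF.comp (by fun_prop : Continuous fun t : ℝ => (s, t))).aestronglyMeasurable
  · exact (hF.comp (by fun_prop : Continuous fun t : ℝ => (x₀, t))).intervalIntegrable _ _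
  · rw [uIoc_of_le hab]
    exact (hF'x₀.mono Ioc_subset_Icc_self).aestronglyMeasurable measurableSet_Ioc
  · exact .of_forall fun t ht x hx => hC (x, t) ⟨hx, hIoc t ht⟩
  · exact .of_forall fun t ht x hx => hd (x, t) (hsub ⟨hx, hIoc t ht⟩)

open Set in
/-- The derivative of `s ↦ ∫ R √W` where the radicand `W` is positive along `s = 0`. -/
theorem hasDerivAt_intervalIntegral_mul_sqrt {a b : ℝ} (hab : a ≤ b)
    {R R' W W' : ℝ → ℝ → ℝ}
    (hR : Continuous fun p : ℝ × ℝ => R p.1 p.2)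
    (hR' : Continuous fun p : ℝ × ℝ => R' p.1 p.2)
    (hW : Continuous fun p : ℝ × ℝ => W p.1 p.2)
    (hW' : Continuous fun p : ℝ × ℝ => W' p.1 p.2)
    (hdR : ∀ s t, HasDerivAt (fun s => R s t) (R' s t) s)
    (hdW : ∀ s t, HasDerivAt (fun s => W s t) (W' s t) s)
    (hpos : ∀ t ∈ Icc a b, 0 < W 0 t) :
    HasDerivAt (fun s => ∫ t in a..b, R s t * √(W s t))
      (∫ t in a..b, (R' 0 t * √(W 0 t) + R 0 t * (W' 0 t / (2 * √(W 0 t))))) 0 := by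
  refine hasDerivAt_intervalIntegral_of_continuousOn hab
    (F' := fun s t => R' s t * √(W s t) + R s t * (W' s t / (2 * √(W s t))))
    (isOpen_lt continuous_const hW) hpos (by fun_prop) ?_ ?_
  · have hne : ∀ p ∈ {p : ℝ × ℝ | 0 < W p.1 p.2}, 2 * √(W p.1 p.2) ≠ 0 := fun p hp =>
      mul_ne_zero two_ne_zero (Real.sqrt_pos.2 hp).ne'
    exact (hR'.mul hW.sqrt).continuousOn.add (hR.continuousOn.mul
      (hW'.continuousOn.div (continuous_const.mul hW.sqrt).continuousOn hne))
  · rintro ⟨s, t⟩ hp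
    exact (hdR s t).mul ((hdW s t).sqrt (ne_of_gt hp))

open Set MeasureTheory in
/-- Integration by parts against a test function vanishing at the endpoints. -/
theorem integral_mul_add_mul_deriv_eq {a b : ℝ} (hab : a ≤ b) {P Q Q' φ : ℝ → ℝ}
    (hP : ContinuousOn P (Icc a b)) (hQ : ∀ t ∈ Icc a b, HasDerivAt Q (Q' t) t)
    (hQ' : ContinuousOn Q' (Icc a b)) (hφ : ContDiff ℝ (⊤ : ℕ∞) φ)
    (hφa : φ a = 0) (hφb : φ b = 0) :
    IntervalIntegrable (fun t => P t * φ t + Q t * deriv φ t) volume a b ∧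
    ∫ t in a..b, (P t * φ t + Q t * deriv φ t) = ∫ t in a..b, (P t - Q' t) * φ t := by
  have hφ' : Continuous (deriv φ) := hφ.continuous_deriv (by simp)
  have hφc : Continuous φ := hφ.continuous
  have hQc : ContinuousOn Q (Icc a b) := fun t ht => (hQ t ht).continuousAt.continuousWithinAt
  rw [← uIcc_of_le hab] at hP hQ hQ' hQc
  have i1 : IntervalIntegrable (fun t => P t * φ t) volume a b :=
    (hP.mul hφc.continuousOn).intervalIntegrable
  have i2 : IntervalIntegrable (fun t => Q t * deriv φ t) volume a b :=
    (hQc.mul hφ'.continuousOn).intervalIntegrable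
  have i3 : IntervalIntegrable (fun t => Q' t * φ t) volume a b :=
    (hQ'.mul hφc.continuousOn).intervalIntegrable
  have parts := intervalIntegral.integral_mul_deriv_eq_deriv_mul hQ
    (fun t _ => (hφ.differentiable (by simp) t).hasDerivAt)
    hQ'.intervalIntegrable (hφ'.intervalIntegrable a b)
  refine ⟨i1.add i2, ?_⟩
  simp only [sub_mul]
  rw [intervalIntegral.integral_add i1 i2, intervalIntegral.integral_sub i1 i3, parts]
  simp [hφa, hφb, sub_eq_add_neg]

open Set MeasureTheory in
/-- The fundamental lemma of the calculus of variations on a compact interval. -/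
theorem eqOn_zero_of_integral_mul_eq_zero {a b : ℝ} (hab : a < b) {f : ℝ → ℝ}
    (hf : ContinuousOn f (Icc a b))
    (h : ∀ φ : ℝ → ℝ, ContDiff ℝ (⊤ : ℕ∞) φ → φ a = 0 → φ b = 0 →
      ∫ t in a..b, f t * φ t = 0) :
    ∀ t ∈ Icc a b, f t = 0 := by
  have key : ∀ᵐ t, t ∈ Ioo a b → f t = 0 := by
    refine isOpen_Ioo.ae_eq_zero_of_integral_contDiff_smul_eq_zero
      ((hf.mono Ioo_subset_Icc_self).locallyIntegrableOn measurableSet_Ioo) ?_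
    intro φ hφ _ hsupp
    have hout : ∀ t, t ∉ Ioo a b → φ t = 0 := fun t ht =>
      image_eq_zero_of_notMem_tsupport fun h' => ht (hsupp h')
    have h0 := h φ hφ (hout a (by simp)) (hout b (by simp))
    rw [intervalIntegral.integral_of_le hab.le, setIntegral_eq_integral_of_forall_compl_eq_zero]
      at h0
    · simpa only [smul_eq_mul, mul_comm] using h0
    · intro t ht
      rw [hout t fun h' => ht (Ioo_subset_Ioc_self h'), mul_zero]
  refine Measure.eqOn_Icc_of_ae_eq volume hab.ne ?_ hf continuousOn_const
  rw [← restrict_Ioo_eq_restrict_Icc]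
  exact (ae_restrict_iff' measurableSet_Ioo).2 key

/-- The determinant of position, velocity and acceleration of a curve on the de Sitter plane, in the
coordinates `Psi`. -/
theorem det3_Psi_deriv {u v : ℝ → ℝ} (hu : ContDiff ℝ (⊤ : ℕ∞) u) (hv : ContDiff ℝ (⊤ : ℕ∞) v)
    {γ : ℝ → Fin 3 → ℝ} (hγ : ∀ t, γ t = Psi (u t) (v t)) (t : ℝ) :
    det3 (γ t) (deriv γ t) (deriv (deriv γ) t) =
      deriv v t * (Real.cosh (u t) * deriv (deriv u) t
          + Real.cosh (u t) ^ 2 * Real.sinh (u t) * deriv v t ^ 2)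
        - deriv u t * (Real.cosh (u t) * deriv (deriv v) t
          + 2 * deriv u t * deriv v t * Real.sinh (u t)) := by
  have du : ∀ t, HasDerivAt u (deriv u t) t := fun t =>
    (hu.differentiable (by simp) t).hasDerivAt
  have dv : ∀ t, HasDerivAt v (deriv v t) t := fun t =>
    (hv.differentiable (by simp) t).hasDerivAt
  have ddu : ∀ t, HasDerivAt (deriv u) (deriv (deriv u) t) t := fun t =>
    ((contDiff_infty_iff_deriv.1 hu).2.differentiable (by simp) t).hasDerivAt
  have ddv : ∀ t, HasDerivAt (deriv v) (deriv (deriv v) t) t := fun t =>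
    ((contDiff_infty_iff_deriv.1 hv).2.differentiable (by simp) t).hasDerivAt
  obtain rfl : γ = fun t => Psi (u t) (v t) := funext hγ
  have h1 : deriv (fun t => Psi (u t) (v t)) = fun t =>
      ![sinh (u t) * deriv u t * cos (v t) + cosh (u t) * (-sin (v t) * deriv v t),
        sinh (u t) * deriv u t * sin (v t) + cosh (u t) * (cos (v t) * deriv v t),
        cosh (u t) * deriv u t] := by
    funext t
    refine HasDerivAt.deriv (hasDerivAt_pi.2 fun i => ?_)
    fin_cases i
    · exact (du t).cosh.mul (dv t).cos
    · exact (du t).cosh.mul (dv t).sin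
    · exact (du t).sinh
  have h2 : deriv (deriv fun t => Psi (u t) (v t)) t =
      ![((cosh (u t) * deriv u t) * deriv u t + sinh (u t) * deriv (deriv u) t) * cos (v t)
          + sinh (u t) * deriv u t * (-sin (v t) * deriv v t)
          + (sinh (u t) * deriv u t * (-sin (v t) * deriv v t)
            + cosh (u t) * (-(cos (v t) * deriv v t) * deriv v t
              + -sin (v t) * deriv (deriv v) t)),
        ((cosh (u t) * deriv u t) * deriv u t + sinh (u t) * deriv (deriv u) t) * sin (v t)
          + sinh (u t) * deriv u t * (cos (v t) * deriv v t)
          + (sinh (u t) * deriv u t * (cos (v t) * deriv v t)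
            + cosh (u t) * ((-sin (v t) * deriv v t) * deriv v t
              + cos (v t) * deriv (deriv v) t)),
        (sinh (u t) * deriv u t) * deriv u t + cosh (u t) * deriv (deriv u) t] := by
    rw [h1]
    refine HasDerivAt.deriv (hasDerivAt_pi.2 fun i => ?_)
    fin_cases i
    · exact (((du t).sinh.mul (ddu t)).mul (dv t).cos).add
        ((du t).cosh.mul ((dv t).sin.neg.mul (ddv t)))
    · exact (((du t).sinh.mul (ddu t)).mul (dv t).sin).add
        ((du t).cosh.mul ((dv t).cos.mul (ddv t)))
    · exact (du t).cosh.mul (ddu t)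
  rw [h2, h1]
  simp only [det3, Psi, Matrix.cons_val_zero, Matrix.cons_val_one, Matrix.cons_val]
  have hc : cosh (u t) ^ 2 = sinh (u t) ^ 2 + 1 := Real.cosh_sq _
  have hs : sin (v t) ^ 2 = 1 - cos (v t) ^ 2 := Real.sin_sq _
  generalize deriv u t = p, deriv v t = q, deriv (deriv u) t = p', deriv (deriv v) t = q',
    sin (v t) = S, cos (v t) = C, cosh (u t) = c, sinh (u t) = s at *
  linear_combination
    (c * (q * c * (p' * c + p ^ 2 * s) - p * c * (q' * c + 2 * p * q * s))
      + s * (p * s * (q' * c + 2 * p * q * s) - q * c * (p' * s + p ^ 2 * c - q ^ 2 * c))) * hs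
    + (q * c * p' - p * (q' * c + 2 * p * q * s)) * hc

open Set MeasureTheory in
/-- The first variation of the energy with density `cosh u sin v - sinh u + lam`. -/
theorem hasDerivAt_parabolic_energy {a b : ℝ} (hab : a ≤ b) (lam ε : ℝ) {u v φ ψ : ℝ → ℝ}
    (hu : ContDiff ℝ (⊤ : ℕ∞) u) (hv : ContDiff ℝ (⊤ : ℕ∞) v)
    (hφ : ContDiff ℝ (⊤ : ℕ∞) φ) (hψ : ContDiff ℝ (⊤ : ℕ∞) ψ) {sp : ℝ → ℝ}
    (hsp : ∀ t, sp t = √(ε * (deriv v t ^ 2 * cosh (u t) ^ 2 - deriv u t ^ 2)))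
    (hnd : ∀ t ∈ Icc a b, 0 < ε * (deriv v t ^ 2 * cosh (u t) ^ 2 - deriv u t ^ 2)) :
    HasDerivAt (fun s : ℝ => ∫ t in a..b,
      (cosh (u t + s * φ t) * sin (v t + s * ψ t) - sinh (u t + s * φ t) + lam) *
        √(ε * ((deriv v t + s * deriv ψ t) ^ 2 * cosh (u t + s * φ t) ^ 2
          - (deriv u t + s * deriv φ t) ^ 2)))
      (∫ t in a..b,
        ((((sinh (u t) * sin (v t) - cosh (u t)) * sp t
            + (cosh (u t) * sin (v t) - sinh (u t) + lam)
              * (ε * (deriv v t ^ 2 * (cosh (u t) * sinh (u t)))) / sp t) * φ t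
          + -((cosh (u t) * sin (v t) - sinh (u t) + lam) * (ε * deriv u t) / sp t)
            * deriv φ t)
        + (cosh (u t) * cos (v t) * sp t * ψ t
          + (cosh (u t) * sin (v t) - sinh (u t) + lam)
            * (ε * (deriv v t * cosh (u t) ^ 2)) / sp t * deriv ψ t))) 0 := by
  have cu : Continuous u := hu.continuous
  have cv : Continuous v := hv.continuous
  have cφ : Continuous φ := hφ.continuous
  have cψ : Continuous ψ := hψ.continuous
  have cu' : Continuous (deriv u) := hu.continuous_deriv (by simp)
  have cv' : Continuous (deriv v) := hv.continuous_deriv (by simp)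
  have cφ' : Continuous (deriv φ) := hφ.continuous_deriv (by simp)
  have cψ' : Continuous (deriv ψ) := hψ.continuous_deriv (by simp)
  have line : ∀ x y s : ℝ, HasDerivAt (fun s => x + s * y) y s := fun x y s => by
    simpa using ((hasDerivAt_id s).mul_const y).const_add x
  have key := hasDerivAt_intervalIntegral_mul_sqrt hab
    (R := fun s t => cosh (u t + s * φ t) * sin (v t + s * ψ t) - sinh (u t + s * φ t) + lam)
    (R' := fun s t => sinh (u t + s * φ t) * φ t * sin (v t + s * ψ t)
      + cosh (u t + s * φ t) * (cos (v t + s * ψ t) * ψ t) - cosh (u t + s * φ t) * φ t)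
    (W := fun s t => ε * ((deriv v t + s * deriv ψ t) ^ 2 * cosh (u t + s * φ t) ^ 2
      - (deriv u t + s * deriv φ t) ^ 2))
    (W' := fun s t => ε * ((2 * (deriv v t + s * deriv ψ t) * deriv ψ t)
        * cosh (u t + s * φ t) ^ 2
      + (deriv v t + s * deriv ψ t) ^ 2
        * (2 * cosh (u t + s * φ t) * (sinh (u t + s * φ t) * φ t))
      - 2 * (deriv u t + s * deriv φ t) * deriv φ t))
    (by fun_prop) (by fun_prop) (by fun_prop) (by fun_prop)
    (fun s t => ((((line (u t) (φ t) s).cosh.mul (line (v t) (ψ t) s).sin).sub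
      (line (u t) (φ t) s).sinh).add_const lam))
    (fun s t => by
      have h := ((((line (deriv v t) (deriv ψ t) s).pow 2).mul
        ((line (u t) (φ t) s).cosh.pow 2)).sub ((line (deriv u t) (deriv φ t) s).pow 2)).const_mul ε
      exact h.congr_deriv (by simp))
    (by simpa using hnd)
  refine key.congr_deriv (intervalIntegral.integral_congr fun t ht => ?_)
  rw [uIcc_of_le hab] at ht
  have hpos : sp t ≠ 0 := by
    rw [hsp]
    exact (Real.sqrt_pos.2 (hnd t ht)).ne'
  simp only [zero_mul, add_zero, ← hsp]
  field_simp
  ring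

/-- The common factor of the two Euler–Lagrange expressions vanishes exactly when the curvature
equation holds, and each expression is this factor times a component of the velocity. -/
theorem parabolic_euler_lagrange {ε ρ ρu ρv p q p' q' c s w κ : ℝ} (hw : w ≠ 0)
    (hw2 : w ^ 2 = ε * (q ^ 2 * c ^ 2 - p ^ 2))
    (hκ : κ = ε * (q * (c * p' + c ^ 2 * s * q ^ 2) - p * (c * q' + 2 * p * q * s)) / w ^ 3) :
    ρu * w + ρ * (ε * (q ^ 2 * (c * s))) / w
      - -((((ρu * p + c * ρv * q) * (ε * p) + ρ * (ε * p')) * w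
        - ρ * (ε * p) * (ε * ((2 * q * q') * c ^ 2 + q ^ 2 * (2 * c * (s * p)) - 2 * p * p')
          / (2 * w))) / w ^ 2)
      = ε * q * c * (ρ * κ + (q * c * ρu + p * ρv) / w) ∧
    c * ρv * w
      - (((ρu * p + c * ρv * q) * (ε * (q * c ^ 2))
          + ρ * (ε * (q' * c ^ 2 + q * (2 * c * (s * p))))) * w
        - ρ * (ε * (q * c ^ 2))
          * (ε * ((2 * q * q') * c ^ 2 + q ^ 2 * (2 * c * (s * p)) - 2 * p * p') / (2 * w)))
        / w ^ 2
      = -(ε * p * c) * (ρ * κ + (q * c * ρu + p * ρv) / w) := by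
  subst hκ
  constructor
  · field_simp
    linear_combination (ρu * w ^ 2 + ε * ρ * (q ^ 2 * c * s + p')) * hw2
  · field_simp
    linear_combination c * (ρv * w ^ 2 - ε * ρ * (c * q' + 2 * p * q * s)) * hw2

theorem parabolic_catenary_characterization
    (a b lam : ℝ) (hab : a < b)
    (u v : ℝ → ℝ) (hu : ContDiff ℝ (⊤ : ℕ∞) u) (hv : ContDiff ℝ (⊤ : ℕ∞) v)
    (ε : ℝ) (hε : ε = 1 ∨ ε = -1)
    (γ : ℝ → Fin 3 → ℝ) (hγ : ∀ t, γ t = Psi (u t) (v t))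
    (sp : ℝ → ℝ)
    (hsp : ∀ t, sp t =
      Real.sqrt (ε * ((deriv v t) ^ 2 * Real.cosh (u t) ^ 2 - (deriv u t) ^ 2)))
    (hnd : ∀ t ∈ Set.Icc a b,
      0 < ε * ((deriv v t) ^ 2 * Real.cosh (u t) ^ 2 - (deriv u t) ^ 2))
    (κ : ℝ → ℝ)
    (hκ : ∀ t, κ t = ε * det3 (γ t) (deriv γ t) (deriv (deriv γ) t) / sp t ^ 3)
    (hd : ∀ t ∈ Set.Icc a b,
      0 < Real.cosh (u t) * Real.sin (v t) - Real.sinh (u t))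
    (hne : ∀ t ∈ Set.Icc a b,
      Real.cosh (u t) * Real.sin (v t) - Real.sinh (u t) + lam ≠ 0) :
    IsCritical (fun x y => Real.cosh x * Real.sin y - Real.sinh x + lam) ε u v a b ↔
      ∀ t ∈ Set.Icc a b,
        κ t = -(deriv v t * Real.cosh (u t)
              * (Real.sinh (u t) * Real.sin (v t) - Real.cosh (u t))
            + deriv u t * Real.cos (v t))
          / ((Real.cosh (u t) * Real.sin (v t) - Real.sinh (u t) + lam) * sp t) := by
  have du : ∀ t, HasDerivAt u (deriv u t) t := fun t =>
    (hu.differentiable (by simp) t).hasDerivAt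
  have dv : ∀ t, HasDerivAt v (deriv v t) t := fun t =>
    (hv.differentiable (by simp) t).hasDerivAt
  have hu' := (contDiff_infty_iff_deriv.1 hu).2
  have hv' := (contDiff_infty_iff_deriv.1 hv).2
  have ddu : ∀ t, HasDerivAt (deriv u) (deriv (deriv u) t) t := fun t =>
    (hu'.differentiable (by simp) t).hasDerivAt
  have ddv : ∀ t, HasDerivAt (deriv v) (deriv (deriv v) t) t := fun t =>
    (hv'.differentiable (by simp) t).hasDerivAt
  have cu : Continuous u := hu.continuous
  have cv : Continuous v := hv.continuous
  have cu' : Continuous (deriv u) := hu'.continuous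
  have cv' : Continuous (deriv v) := hv'.continuous
  have cu'' : Continuous (deriv (deriv u)) := hu'.continuous_deriv (by simp)
  have cv'' : Continuous (deriv (deriv v)) := hv'.continuous_deriv (by simp)
  have csp : Continuous sp := by
    rw [funext hsp]
    fun_prop
  have hsp0 : ∀ t ∈ Set.Icc a b, sp t ≠ 0 := fun t ht => by
    rw [hsp]
    exact (Real.sqrt_pos.2 (hnd t ht)).ne'
  have hsp2 : ∀ t ∈ Set.Icc a b,
      sp t ^ 2 = ε * (deriv v t ^ 2 * cosh (u t) ^ 2 - deriv u t ^ 2) := fun t ht => by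
    rw [hsp, Real.sq_sqrt (hnd t ht).le]
  have hε0 : ε ≠ 0 := by rcases hε with rfl | rfl <;> norm_num
  have hκ' : ∀ t, κ t = ε * (deriv v t * (cosh (u t) * deriv (deriv u) t
        + cosh (u t) ^ 2 * sinh (u t) * deriv v t ^ 2)
      - deriv u t * (cosh (u t) * deriv (deriv v) t
        + 2 * deriv u t * deriv v t * sinh (u t))) / sp t ^ 3 := fun t => by
    rw [hκ, det3_Psi_deriv hu hv hγ]
  set ρ : ℝ → ℝ := fun t => cosh (u t) * sin (v t) - sinh (u t) + lam
  set ρu : ℝ → ℝ := fun t => sinh (u t) * sin (v t) - cosh (u t) with hρu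
  have cρ : Continuous ρ := by fun_prop
  have cρu : Continuous ρu := by fun_prop
  have dρ : ∀ t, HasDerivAt ρ (ρu t * deriv u t + cosh (u t) * cos (v t) * deriv v t) t :=
    fun t => ((((du t).cosh.mul (dv t).sin).sub (du t).sinh).add_const lam).congr_deriv (by
      simp only [hρu]; ring)
  set W' : ℝ → ℝ := fun t => ε * ((2 * deriv v t * deriv (deriv v) t) * cosh (u t) ^ 2
    + deriv v t ^ 2 * (2 * cosh (u t) * (sinh (u t) * deriv u t))
    - 2 * deriv u t * deriv (deriv u) t) with hW'
  have cW' : Continuous W' := by fun_prop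
  have dsp : ∀ t ∈ Set.Icc a b, HasDerivAt sp (W' t / (2 * sp t)) t := fun t ht => by
    have h := (((((ddv t).pow 2).mul ((du t).cosh.pow 2)).sub ((ddu t).pow 2)).const_mul ε).sqrt
      (hnd t ht).ne'
    rw [hsp t, funext hsp]
    exact h.congr_deriv (by simp [hW'])
  have dQ : ∀ t ∈ Set.Icc a b, HasDerivAt (fun t => -(ρ t * (ε * deriv u t) / sp t))
      (-((((ρu t * deriv u t + cosh (u t) * cos (v t) * deriv v t) * (ε * deriv u t)
        + ρ t * (ε * deriv (deriv u) t)) * sp t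
        - ρ t * (ε * deriv u t) * (W' t / (2 * sp t))) / sp t ^ 2)) t := fun t ht =>
    (((dρ t).mul ((ddu t).const_mul ε)).div (dsp t ht) (hsp0 t ht)).neg
  have dS : ∀ t ∈ Set.Icc a b,
      HasDerivAt (fun t => ρ t * (ε * (deriv v t * cosh (u t) ^ 2)) / sp t)
      ((((ρu t * deriv u t + cosh (u t) * cos (v t) * deriv v t)
          * (ε * (deriv v t * cosh (u t) ^ 2))
        + ρ t * (ε * (deriv (deriv v) t * cosh (u t) ^ 2
          + deriv v t * (2 * cosh (u t) * (sinh (u t) * deriv u t))))) * sp t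
        - ρ t * (ε * (deriv v t * cosh (u t) ^ 2)) * (W' t / (2 * sp t))) / sp t ^ 2) t :=
    fun t ht => by
      have h := ((dρ t).mul (((ddv t).mul ((du t).cosh.pow 2)).const_mul ε)).div
        (dsp t ht) (hsp0 t ht)
      exact h.congr_deriv (by simp)
  have cdsp : ContinuousOn (fun t => W' t / (2 * sp t)) (Set.Icc a b) :=
    cW'.continuousOn.div (by fun_prop) fun t ht => mul_ne_zero two_ne_zero (hsp0 t ht)
  set A : ℝ → ℝ := fun t =>
    ρ t * κ t + (deriv v t * cosh (u t) * ρu t + deriv u t * cos (v t)) / sp t with hA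
  have cA : ContinuousOn A (Set.Icc a b) := by
    have cκ : ContinuousOn κ (Set.Icc a b) := by
      rw [funext hκ']
      exact ContinuousOn.div (by fun_prop) (by fun_prop) fun t ht => pow_ne_zero 3 (hsp0 t ht)
    exact (cρ.continuousOn.mul cκ).add
      (ContinuousOn.div (by fun_prop) (by fun_prop) hsp0)
  have hEL := fun t (ht : t ∈ Set.Icc a b) =>
    parabolic_euler_lagrange (ρ := ρ t) (ρu := ρu t) (ρv := cos (v t))
      (hsp0 t ht) (hsp2 t ht) (hκ' t)
  have variation : ∀ φ ψ : ℝ → ℝ, ContDiff ℝ (⊤ : ℕ∞) φ → ContDiff ℝ (⊤ : ℕ∞) ψ →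
      φ a = 0 → φ b = 0 → ψ a = 0 → ψ b = 0 →
      deriv (fun s : ℝ => ∫ t in a..b,
        (cosh (u t + s * φ t) * sin (v t + s * ψ t) - sinh (u t + s * φ t) + lam) *
          √(ε * ((deriv v t + s * deriv ψ t) ^ 2 * cosh (u t + s * φ t) ^ 2
            - (deriv u t + s * deriv φ t) ^ 2))) 0
      = (∫ t in a..b, ε * deriv v t * cosh (u t) * A t * φ t)
        + ∫ t in a..b, -(ε * deriv u t * cosh (u t)) * A t * ψ t := by
    intro φ ψ hφ hψ hφa hφb hψa hψb
    obtain ⟨i1, e1⟩ := integral_mul_add_mul_deriv_eq hab.le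
      (P := fun t => ρu t * sp t
        + ρ t * (ε * (deriv v t ^ 2 * (cosh (u t) * sinh (u t)))) / sp t)
      (ContinuousOn.add (by fun_prop) (ContinuousOn.div (by fun_prop) (by fun_prop) hsp0))
      dQ (ContinuousOn.neg (ContinuousOn.div (by fun_prop) (by fun_prop)
        fun t ht => pow_ne_zero 2 (hsp0 t ht))) hφ hφa hφb
    obtain ⟨i2, e2⟩ := integral_mul_add_mul_deriv_eq hab.le
      (P := fun t => cosh (u t) * cos (v t) * sp t) (by fun_prop)
      dS (ContinuousOn.div (by fun_prop) (by fun_prop)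
        fun t ht => pow_ne_zero 2 (hsp0 t ht)) hψ hψa hψb
    rw [(hasDerivAt_parabolic_energy hab.le lam ε hu hv hφ hψ hsp hnd).deriv]
    refine (intervalIntegral.integral_add i1 i2).trans ?_
    rw [e1, e2]
    congr 1
    · refine intervalIntegral.integral_congr fun t ht => ?_
      rw [Set.uIcc_of_le hab.le] at ht
      exact congrArg (· * φ t) (hEL t ht).1
    · refine intervalIntegral.integral_congr fun t ht => ?_
      rw [Set.uIcc_of_le hab.le] at ht
      exact congrArg (· * ψ t) ((hEL t ht).2.trans (by simp only [hA]))
  have hA_iff : ∀ t ∈ Set.Icc a b, (A t = 0 ↔ κ t = -(deriv v t * cosh (u t) * ρu t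
      + deriv u t * cos (v t)) / (ρ t * sp t)) := fun t ht => by
    have h1 := hsp0 t ht
    have h2 : ρ t ≠ 0 := hne t ht
    rw [eq_div_iff (mul_ne_zero h2 h1)]
    simp only [hA]
    rw [← mul_left_inj' h1, zero_mul, add_mul, div_mul_cancel₀ _ h1]
    constructor <;> intro h <;> linear_combination h
  refine Iff.trans ?_ (forall₂_congr hA_iff)
  constructor
  · intro hcrit t ht
    have hv0 := eqOn_zero_of_integral_mul_eq_zero hab
      (f := fun t => ε * deriv v t * cosh (u t) * A t)
      (ContinuousOn.mul (by fun_prop) cA) (fun φ hφ hφa hφb => by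
        have h := variation φ 0 hφ contDiff_const hφa hφb rfl rfl
        rw [hcrit φ 0 hφ contDiff_const hφa hφb rfl rfl] at h
        simpa using h.symm) t ht
    have hu0 := eqOn_zero_of_integral_mul_eq_zero hab
      (f := fun t => -(ε * deriv u t * cosh (u t)) * A t)
      (ContinuousOn.mul (by fun_prop) cA) (fun ψ hψ hψa hψb => by
        have h := variation 0 ψ contDiff_const hψ rfl rfl hψa hψb
        rw [hcrit 0 ψ contDiff_const hψ rfl rfl hψa hψb] at h
        simpa using h.symm) t ht
    by_contra hAt
    have hc : cosh (u t) ≠ 0 := (cosh_pos _).ne'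
    have hp : deriv u t = 0 := by simpa [hε0, hc, hAt] using hu0
    have hq : deriv v t = 0 := by simpa [hε0, hc, hAt] using hv0
    have := hnd t ht
    simp [hp, hq] at this
  · intro hA0 φ ψ hφ hψ hφa hφb hψa hψb
    have hint : ∀ f χ : ℝ → ℝ, ∫ t in a..b, f t * A t * χ t = 0 := fun f χ => by
      rw [intervalIntegral.integral_congr (g := fun _ => 0) fun t ht => ?_,
        intervalIntegral.integral_zero]
      rw [Set.uIcc_of_le hab.le] at ht
      simp [hA0 t ht]
    refine (variation φ ψ hφ hψ hφa hφb hψa hψb).trans ?_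
    rw [hint fun t => ε * deriv v t * cosh (u t), hint fun t => -(ε * deriv u t * cosh (u t)),
      add_zero]
end
end

section
/- (Parabolic rotational minimal surfaces.) Let u : ℝ → ℝ be smooth on [a,b] with cosh(u(t)) sin(t) − sinh(u(t)) > 0 and ε(cosh(u(t))² − u'(t)²) > 0 for all t, |γ'(t)| = √(ε(cosh(u)² − u'²)), let γ(t) = Ψ(u(t), t) with geodesic curvature κ, and let r(t,s) = ( cos(t) cosh(u), (s²/2) sinh(u) − ((s² − 2)/2) sin(t) cosh(u), ((s² + 2)/2) sinh(u) − (s²/2) sin(t) cosh(u), s (sinh(u) − sin(t) cosh(u)) ) be the associated rotational surface of parabolic type in S₁³. Then r is minimal if and only if κ(t) = − ( cosh(u(t)) (sinh(u(t)) sin(t) − cosh(u(t))) + u'(t) cos(t) ) / ( (cosh(u(t)) sin(t) − sinh(u(t))) · |γ'(t)| ) for all t ∈ [a,b], i.e. if and only if γ satisfies the catenary equation with respect to the degenerate plane {y − z = 0} with Lagrange multiplier λ = 0. -/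
noncomputable section

open Real

/-- Lorentzian inner product on `ℝ⁴`: `B(p,q) = p₁q₁ + p₂q₂ − p₃q₃ + p₄q₄`. -/
def B4 (p q : Fin 4 → ℝ) : ℝ := p 0 * q 0 + p 1 * q 1 - p 2 * q 2 + p 3 * q 3

theorem hasDerivAt_deriv_of_contDiff {f : ℝ → ℝ} (hf : ContDiff ℝ (⊤ : ℕ∞) f) (t : ℝ) :
    HasDerivAt f (deriv f t) t ∧ HasDerivAt (deriv f) (deriv (deriv f) t) t :=
  ⟨(hf.differentiable (by simp) t).hasDerivAt,
    ((hf.iterate_deriv 1).differentiable (by simp) t).hasDerivAt⟩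

theorem hasDerivAt_vec3 {f g h : ℝ → ℝ} {f' g' h' t : ℝ}
    (hf : HasDerivAt f f' t) (hg : HasDerivAt g g' t) (hh : HasDerivAt h h' t) :
    HasDerivAt (fun τ => ![f τ, g τ, h τ]) ![f', g', h'] t := by
  rw [hasDerivAt_pi]
  intro i
  fin_cases i <;> simpa

theorem hasDerivAt_vec4 {f g h k : ℝ → ℝ} {f' g' h' k' t : ℝ}
    (hf : HasDerivAt f f' t) (hg : HasDerivAt g g' t) (hh : HasDerivAt h h' t)
    (hk : HasDerivAt k k' t) :
    HasDerivAt (fun τ => ![f τ, g τ, h τ, k τ]) ![f', g', h', k'] t := by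
  rw [hasDerivAt_pi]
  intro i
  fin_cases i <;> simpa

/-- The orbit of `(x, y, z, 0)` under the parabolic rotations of `L⁴`. -/
def parabolicOrbit (x y z s : ℝ) : Fin 4 → ℝ :=
  ![x, y - s ^ 2 / 2 * (y - z), z - s ^ 2 / 2 * (y - z), -s * (y - z)]

theorem hasDerivAt_parabolicOrbit_left {x y z : ℝ → ℝ} {x' y' z' t : ℝ} (s : ℝ)
    (hx : HasDerivAt x x' t) (hy : HasDerivAt y y' t) (hz : HasDerivAt z z' t) :
    HasDerivAt (fun τ => parabolicOrbit (x τ) (y τ) (z τ) s) (parabolicOrbit x' y' z' s) t :=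
  hasDerivAt_vec4 hx (hy.sub ((hy.sub hz).const_mul _)) (hz.sub ((hy.sub hz).const_mul _))
    ((hy.sub hz).const_mul _)

theorem hasDerivAt_parabolicOrbit_right (x y z s : ℝ) :
    HasDerivAt (parabolicOrbit x y z) ![0, -s * (y - z), -s * (y - z), -(y - z)] s := by
  have hq : HasDerivAt (fun σ : ℝ => σ ^ 2 / 2 * (y - z)) (s * (y - z)) s := by
    refine (((hasDerivAt_pow 2 s).div_const 2).mul_const (y - z)).congr_deriv ?_
    norm_num
  have hl : HasDerivAt (fun σ : ℝ => -σ * (y - z)) (-(y - z)) s :=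
    ((hasDerivAt_neg s).mul_const (y - z)).congr_deriv (by ring)
  exact hasDerivAt_vec4 (hasDerivAt_const s x) ((hq.const_sub y).congr_deriv (by ring))
    ((hq.const_sub z).congr_deriv (by ring)) hl

theorem deriv_deriv_parabolicOrbit_right (x y z s : ℝ) :
    deriv (deriv (parabolicOrbit x y z)) s = ![0, -(y - z), -(y - z), 0] := by
  rw [funext fun σ => (hasDerivAt_parabolicOrbit_right x y z σ).deriv]
  have hl : HasDerivAt (fun σ : ℝ => -σ * (y - z)) (-(y - z)) s :=
    ((hasDerivAt_neg s).mul_const (y - z)).congr_deriv (by ring)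
  exact (hasDerivAt_vec4 (hasDerivAt_const s 0) hl hl (hasDerivAt_const s _)).deriv

/-- Two linear forms that vanish on the linearly independent vectors `(x, y, z)` and `(x₁, y₁, z₁)`
are proportional; here one of them is `det3 (x, y, z) (x₁, y₁, z₁)`. -/
theorem orthogonal_proportional_det {x y z x₁ y₁ z₁ m n k : ℝ}
    (hγ : m * x + n * y - k * z = 0) (hγ₁ : m * x₁ + n * y₁ - k * z₁ = 0)
    (p q : Fin 3 → ℝ) :
    lprod ![m, n, k] p * det3 ![x, y, z] ![x₁, y₁, z₁] q =
      lprod ![m, n, k] q * det3 ![x, y, z] ![x₁, y₁, z₁] p := by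
  simp only [lprod, det3, Matrix.cons_val]
  linear_combination
    (x * (p 1 * q 2 - p 2 * q 1) - y * (p 0 * q 2 - p 2 * q 0)
      + z * (p 0 * q 1 - p 1 * q 0)) * hγ₁
    - (x₁ * (p 1 * q 2 - p 2 * q 1) - y₁ * (p 0 * q 2 - p 2 * q 0)
      + z₁ * (p 0 * q 1 - p 1 * q 0)) * hγ

/-- Pointwise minimality of a parabolic rotational surface in terms of its generating curve, whose
position, velocity and acceleration are `(x, y, z)`, `(x₁, y₁, z₁)` and `(x₂, y₂, z₂)`. -/
theorem parabolicOrbit_minimal_iff {x y z x₁ y₁ z₁ x₂ y₂ z₂ : ℝ}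
    (h0 : x ^ 2 + y ^ 2 - z ^ 2 = 1) (h1 : x * x₁ + y * y₁ - z * z₁ = 0)
    (hE : x₁ ^ 2 + y₁ ^ 2 - z₁ ^ 2 ≠ 0) (hw : y - z ≠ 0) :
    (∀ s : ℝ, ∀ N : Fin 4 → ℝ, B4 N (parabolicOrbit x y z s) = 0 →
      B4 N (parabolicOrbit x₁ y₁ z₁ s) = 0 →
      B4 N ![0, -s * (y - z), -s * (y - z), -(y - z)] = 0 →
      B4 (parabolicOrbit x₁ y₁ z₁ s) (parabolicOrbit x₁ y₁ z₁ s)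
          * B4 N ![0, -(y - z), -(y - z), 0]
        - 2 * B4 (parabolicOrbit x₁ y₁ z₁ s) ![0, -s * (y - z), -s * (y - z), -(y - z)]
          * B4 N ![0, -s * (y₁ - z₁), -s * (y₁ - z₁), -(y₁ - z₁)]
        + B4 ![0, -s * (y - z), -s * (y - z), -(y - z)]
            ![0, -s * (y - z), -s * (y - z), -(y - z)]
          * B4 N (parabolicOrbit x₂ y₂ z₂ s) = 0) ↔
    (y - z) * det3 ![x, y, z] ![x₁, y₁, z₁] ![x₂, y₂, z₂] =
      (x₁ ^ 2 + y₁ ^ 2 - z₁ ^ 2) * (x * (y₁ - z₁) - (y - z) * x₁) := by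
  constructor
  · intro h
    have := h 0 ![y * z₁ - z * y₁, z * x₁ - x * z₁, -(x * y₁ - y * x₁), 0]
    simp only [B4, parabolicOrbit, Matrix.cons_val] at this
    have := this (by ring) (by ring) (by ring)
    apply mul_left_cancel₀ hw
    simp only [det3, Matrix.cons_val]
    linear_combination this
  · intro h s N hN hN₁ hN₂
    set m := N 0 with hm
    set n := N 1 - s ^ 2 / 2 * (N 1 - N 2) - s * N 3 with hn
    set k := N 2 - s ^ 2 / 2 * (N 1 - N 2) - s * N 3 with hk
    have key : ∀ a b c, B4 N (parabolicOrbit a b c s) = m * a + n * b - k * c := by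
      intro a b c
      simp only [B4, parabolicOrbit, Matrix.cons_val, hm, hn, hk]
      ring
    rw [key] at hN hN₁
    have hq := fun p => orthogonal_proportional_det hN hN₁ p
      ![y * z₁ - z * y₁, z * x₁ - x * z₁, -(x * y₁ - y * x₁)]
    have hdet : det3 ![x, y, z] ![x₁, y₁, z₁]
        ![y * z₁ - z * y₁, z * x₁ - x * z₁, -(x * y₁ - y * x₁)]
        = -(x₁ ^ 2 + y₁ ^ 2 - z₁ ^ 2) := by
      simp only [det3, Matrix.cons_val]
      linear_combination -(x₁ ^ 2 + y₁ ^ 2 - z₁ ^ 2) * h0 + (x * x₁ + y * y₁ - z * z₁) * h1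
    rw [hdet] at hq
    set c := lprod ![m, n, k] ![y * z₁ - z * y₁, z * x₁ - x * z₁, -(x * y₁ - y * x₁)]
    have hp := hq ![x₂, y₂, z₂]
    have hv := hq ![0, 1, 1]
    have hd : det3 ![x, y, z] ![x₁, y₁, z₁] ![0, 1, 1]
        = x * (y₁ - z₁) - (y - z) * x₁ := by
      simp only [det3, Matrix.cons_val]
      ring
    rw [hd] at hv
    simp only [lprod, Matrix.cons_val] at hp hv
    have e1 : B4 (parabolicOrbit x₁ y₁ z₁ s) (parabolicOrbit x₁ y₁ z₁ s)
        = x₁ ^ 2 + y₁ ^ 2 - z₁ ^ 2 := by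
      simp only [B4, parabolicOrbit, Matrix.cons_val]
      ring
    have e2 : B4 (parabolicOrbit x₁ y₁ z₁ s) ![0, -s * (y - z), -s * (y - z), -(y - z)] = 0 := by
      simp only [B4, parabolicOrbit, Matrix.cons_val]
      ring
    have e3 : B4 ![0, -s * (y - z), -s * (y - z), -(y - z)]
        ![0, -s * (y - z), -s * (y - z), -(y - z)] = (y - z) ^ 2 := by
      simp only [B4, Matrix.cons_val]
      ring
    have e4 : B4 N ![0, -(y - z), -(y - z), 0] = -(y - z) * (n - k) := by
      simp only [B4, Matrix.cons_val, hn, hk]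
      ring
    rw [e1, e2, e3, e4, key]
    apply mul_left_cancel₀ hE
    linear_combination
      (x₁ ^ 2 + y₁ ^ 2 - z₁ ^ 2) * (y - z) * hv - (y - z) ^ 2 * hp - c * (y - z) * h

theorem parabolic_rotational_minimal
    (a b : ℝ) (hab : a < b)
    (u : ℝ → ℝ) (hu : ContDiff ℝ (⊤ : ℕ∞) u)
    (ε : ℝ) (hε : ε = 1 ∨ ε = -1)
    (sp : ℝ → ℝ)
    (hsp : ∀ t, sp t = Real.sqrt (ε * (Real.cosh (u t) ^ 2 - (deriv u t) ^ 2)))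
    (hpos : ∀ t ∈ Set.Icc a b, 0 < Real.cosh (u t) * Real.sin t - Real.sinh (u t))
    (hnd : ∀ t ∈ Set.Icc a b, 0 < ε * (Real.cosh (u t) ^ 2 - (deriv u t) ^ 2))
    (γ : ℝ → Fin 3 → ℝ) (hγ : ∀ t, γ t = Psi (u t) t)
    (κ : ℝ → ℝ)
    (hκ : ∀ t, κ t = ε * det3 (γ t) (deriv γ t) (deriv (deriv γ) t) / sp t ^ 3)
    (r : ℝ → ℝ → Fin 4 → ℝ)
    (hr : ∀ t s, r t s = ![Real.cos t * Real.cosh (u t),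
      s ^ 2 / 2 * Real.sinh (u t) - (s ^ 2 - 2) / 2 * Real.sin t * Real.cosh (u t),
      (s ^ 2 + 2) / 2 * Real.sinh (u t) - s ^ 2 / 2 * Real.sin t * Real.cosh (u t),
      s * (Real.sinh (u t) - Real.sin t * Real.cosh (u t))])
    :
    ((∀ t ∈ Set.Icc a b, ∀ s : ℝ, ∀ N : Fin 4 → ℝ,
        B4 N (r t s) = 0 → B4 N (deriv (fun τ => r τ s) t) = 0 →
          B4 N (deriv (r t) s) = 0 →
        B4 (deriv (fun τ => r τ s) t) (deriv (fun τ => r τ s) t)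
            * B4 N (deriv (deriv (r t)) s)
          - 2 * B4 (deriv (fun τ => r τ s) t) (deriv (r t) s)
            * B4 N (deriv (fun σ => deriv (fun τ => r τ σ) t) s)
          + B4 (deriv (r t) s) (deriv (r t) s)
            * B4 N (deriv (deriv (fun τ => r τ s)) t) = 0)
      ↔ (∀ t ∈ Set.Icc a b, κ t = -(Real.cosh (u t) * (Real.sinh (u t) * Real.sin t - Real.cosh (u t)) + deriv u t * Real.cos t) / ((Real.cosh (u t) * Real.sin t - Real.sinh (u t)) * sp t))) := by
  set x : ℝ → ℝ := fun t => cosh (u t) * cos t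
  set y : ℝ → ℝ := fun t => cosh (u t) * sin t with hy
  set z : ℝ → ℝ := fun t => sinh (u t) with hz
  have hxs : ContDiff ℝ (⊤ : ℕ∞) x := hu.cosh.mul contDiff_cos
  have hys : ContDiff ℝ (⊤ : ℕ∞) y := hu.cosh.mul contDiff_sin
  have hzs : ContDiff ℝ (⊤ : ℕ∞) z := hu.sinh
  have hu1 (t : ℝ) : HasDerivAt u (deriv u t) t :=
    (hu.differentiable (by simp) t).hasDerivAt
  have hx' (t : ℝ) : deriv x t = sinh (u t) * deriv u t * cos t + cosh (u t) * -sin t :=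
    ((hu1 t).cosh.mul (hasDerivAt_cos t)).deriv
  have hy' (t : ℝ) : deriv y t = sinh (u t) * deriv u t * sin t + cosh (u t) * cos t :=
    ((hu1 t).cosh.mul (hasDerivAt_sin t)).deriv
  have hz' (t : ℝ) : deriv z t = cosh (u t) * deriv u t := (hu1 t).sinh.deriv
  have hγ0 : γ = fun t => ![x t, y t, z t] := funext hγ
  have hγ1 : deriv γ = fun t => ![deriv x t, deriv y t, deriv z t] := by
    rw [hγ0]
    exact funext fun t => (hasDerivAt_vec3 (hasDerivAt_deriv_of_contDiff hxs t).1
      (hasDerivAt_deriv_of_contDiff hys t).1 (hasDerivAt_deriv_of_contDiff hzs t).1).deriv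
  have hγ2 (t : ℝ) : deriv (deriv γ) t
      = ![deriv (deriv x) t, deriv (deriv y) t, deriv (deriv z) t] := by
    rw [hγ1]
    exact (hasDerivAt_vec3 (hasDerivAt_deriv_of_contDiff hxs t).2
      (hasDerivAt_deriv_of_contDiff hys t).2 (hasDerivAt_deriv_of_contDiff hzs t).2).deriv
  have hr0 : r = fun t s => parabolicOrbit (x t) (y t) (z t) s := by
    funext t s
    rw [hr, parabolicOrbit]
    congr! 1
    · ring
    · simp only [hy, hz]
      congr! 1
      · ring
      · congr! 1
        · ring
        · congr! 1
          ring
  have hrt (t s : ℝ) : deriv (fun τ => r τ s) t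
      = parabolicOrbit (deriv x t) (deriv y t) (deriv z t) s := by
    rw [hr0]
    exact (hasDerivAt_parabolicOrbit_left s (hasDerivAt_deriv_of_contDiff hxs t).1
      (hasDerivAt_deriv_of_contDiff hys t).1 (hasDerivAt_deriv_of_contDiff hzs t).1).deriv
  have hrtt (t s : ℝ) : deriv (deriv (fun τ => r τ s)) t
      = parabolicOrbit (deriv (deriv x) t) (deriv (deriv y) t) (deriv (deriv z) t) s := by
    rw [funext fun τ => hrt τ s]
    exact (hasDerivAt_parabolicOrbit_left s (hasDerivAt_deriv_of_contDiff hxs t).2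
      (hasDerivAt_deriv_of_contDiff hys t).2 (hasDerivAt_deriv_of_contDiff hzs t).2).deriv
  have hrts (t s : ℝ) : deriv (fun σ => deriv (fun τ => r τ σ) t) s
      = ![0, -s * (deriv y t - deriv z t), -s * (deriv y t - deriv z t),
          -(deriv y t - deriv z t)] := by
    rw [funext fun σ => hrt t σ]
    exact (hasDerivAt_parabolicOrbit_right _ _ _ s).deriv
  have hrs (t s : ℝ) : deriv (r t) s
      = ![0, -s * (y t - z t), -s * (y t - z t), -(y t - z t)] := by
    rw [hr0]
    exact (hasDerivAt_parabolicOrbit_right _ _ _ s).deriv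
  have hrss (t s : ℝ) : deriv (deriv (r t)) s = ![0, -(y t - z t), -(y t - z t), 0] := by
    rw [hr0]
    exact deriv_deriv_parabolicOrbit_right _ _ _ s
  refine forall₂_congr fun t ht => ?_
  have hε2 : ε ^ 2 = 1 := by rcases hε with rfl | rfl <;> norm_num
  have hw : 0 < y t - z t := hpos t ht
  have hsp0 : 0 < sp t := by
    rw [hsp]
    exact Real.sqrt_pos.2 (hnd t ht)
  have hE : deriv x t ^ 2 + deriv y t ^ 2 - deriv z t ^ 2 = ε * sp t ^ 2 := by
    rw [hsp, Real.sq_sqrt (hnd t ht).le, hx', hy', hz']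
    linear_combination (sinh (u t) ^ 2 * deriv u t ^ 2 + cosh (u t) ^ 2) * sin_sq_add_cos_sq t
      - (deriv u t ^ 2) * cosh_sq_sub_sinh_sq (u t)
      - (cosh (u t) ^ 2 - deriv u t ^ 2) * hε2
  have hE0 : deriv x t ^ 2 + deriv y t ^ 2 - deriv z t ^ 2 ≠ 0 := by
    rw [hE]
    rcases hε with rfl | rfl <;> simp [hsp0.ne']
  have h0 : x t ^ 2 + y t ^ 2 - z t ^ 2 = 1 := by
    linear_combination cosh (u t) ^ 2 * sin_sq_add_cos_sq t + cosh_sq_sub_sinh_sq (u t)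
  have h1 : x t * deriv x t + y t * deriv y t - z t * deriv z t = 0 := by
    rw [hx', hy', hz']
    linear_combination cosh (u t) * sinh (u t) * deriv u t * sin_sq_add_cos_sq t
  have hD : x t * (deriv y t - deriv z t) - (y t - z t) * deriv x t
      = -(cosh (u t) * (sinh (u t) * sin t - cosh (u t)) + deriv u t * cos t) := by
    rw [hx', hy', hz']
    linear_combination cosh (u t) ^ 2 * sin_sq_add_cos_sq t
      - deriv u t * cos t * cosh_sq_sub_sinh_sq (u t)
  simp only [hrts]
  simp only [hrt, hrtt, hrs, hrss]
  simp only [hr0]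
  rw [parabolicOrbit_minimal_iff h0 h1 hE0 hw.ne', hκ, ← hD, hE, hγ2, congrFun hγ1 t, congrFun hγ0 t]
  change _ ↔ _ = _ / ((y t - z t) * sp t)
  rw [div_eq_div_iff (pow_pos hsp0 3).ne' (mul_pos hw hsp0).ne']
  have hε0 : ε ≠ 0 := by rintro rfl; norm_num at hε2
  constructor
  · intro h
    linear_combination ε * sp t * h
      + sp t ^ 3 * (x t * (deriv y t - deriv z t) - (y t - z t) * deriv x t) * hε2
  · intro h
    apply mul_left_cancel₀ (mul_ne_zero hε0 hsp0.ne')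
    linear_combination h
      - sp t ^ 3 * (x t * (deriv y t - deriv z t) - (y t - z t) * deriv x t) * hε2
end
end

section
/- (Intrinsic catenaries.) Let γ(t) = Ψ(u(t), v(t)) be a nondegenerate curve on [a,b] with u(t) > 0 and u(t) + λ ≠ 0 for all t. Then γ is a critical point of the energy with density ρ(u,v) = u + λ (an intrinsic catenary with respect to the geodesic L = S₁² ∩ {z = 0}, whose intrinsic distance to Ψ(u,v) is u) if and only if its geodesic curvature satisfies κ(t) = − v'(t) cosh(u(t)) / ( (u(t) + λ) · |γ'(t)| ) for all t ∈ [a,b]. -/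
noncomputable section

open Real

open Set Filter Topology MeasureTheory Interval

/-- Differentiation under the integral sign over a compact interval. -/
theorem hasDerivAt_integral_of_continuousOn {G G' : ℝ → ℝ → ℝ} {a b x δ : ℝ} (hab : a ≤ b)
    (hδ : 0 < δ) (hG : ∀ s, Continuous (G s))
    (hG' : ContinuousOn (fun p : ℝ × ℝ => G' p.1 p.2) (Metric.closedBall x δ ×ˢ Icc a b))
    (hderiv : ∀ s ∈ Metric.closedBall x δ, ∀ t ∈ Icc a b,
      HasDerivAt (fun s => G s t) (G' s t) s) :
    HasDerivAt (fun s => ∫ t in a..b, G s t) (∫ t in a..b, G' x t) x := by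
  obtain ⟨C, hC⟩ := ((isCompact_closedBall x δ).prod isCompact_Icc).exists_bound_of_continuousOn hG'
  have hsub : Ι a b ⊆ Icc a b := by
    rw [uIoc_of_le hab]; exact Ioc_subset_Icc_self
  have hx : ContinuousOn (G' x) (Icc a b) :=
    hG'.comp (f := fun t => (x, t)) (by fun_prop)
      fun t ht => ⟨Metric.mem_closedBall_self hδ.le, ht⟩
  refine (intervalIntegral.hasDerivAt_integral_of_dominated_loc_of_deriv_le
    (bound := fun _ => C) (Metric.closedBall_mem_nhds x hδ)
    (Eventually.of_forall fun s => (hG s).aestronglyMeasurable)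
    ((hG x).intervalIntegrable a b)
    ((hx.mono hsub).aestronglyMeasurable measurableSet_uIoc)
    (ae_of_all _ fun t ht s hs => hC (s, t) ⟨hs, hsub ht⟩)
    intervalIntegrable_const
    (ae_of_all _ fun t ht s hs => hderiv s hs t (hsub ht))).2

/-- `ε ⟨γ', γ'⟩` for the curve `γ = Ψ(u, v)` with velocity `(p, q) = (u', v')`. -/
def speedSq (ε u p q : ℝ) : ℝ := ε * (q ^ 2 * Real.cosh u ^ 2 - p ^ 2)

/-- The determinant `det(γ, γ', γ'')` for `γ = Ψ(u, v)`, in terms of `u` and the derivatives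
`p = u'`, `q = v'`, `p' = u''`, `q' = v''`. -/
def curvatureDet (u p q p' q' : ℝ) : ℝ :=
  q * cosh u * (p' + q ^ 2 * cosh u * sinh u) - p * (2 * p * q * sinh u + q' * cosh u)

/-- The normal component, up to a positive factor, of the Euler–Lagrange operator of the energy
with density `u + lam`. -/
def catenaryDefect (ε lam u p q p' q' : ℝ) : ℝ :=
  q * cosh u * speedSq ε u p q + (u + lam) * ε * curvatureDet u p q p' q'

theorem det3_Psi {u v : ℝ → ℝ} (hu : ContDiff ℝ (⊤ : ℕ∞) u) (hv : ContDiff ℝ (⊤ : ℕ∞) v)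
    {γ : ℝ → Fin 3 → ℝ} (hγ : ∀ t, γ t = Psi (u t) (v t)) (t : ℝ) :
    det3 (γ t) (deriv γ t) (deriv (deriv γ) t) =
      curvatureDet (u t) (deriv u t) (deriv v t) (deriv (deriv u) t) (deriv (deriv v) t) := by
  obtain ⟨hu0, hu'⟩ := contDiff_infty_iff_deriv.1 hu
  obtain ⟨hv0, hv'⟩ := contDiff_infty_iff_deriv.1 hv
  have hu1 := (contDiff_infty_iff_deriv.1 hu').1
  have hv1 := (contDiff_infty_iff_deriv.1 hv').1
  have h1 : deriv γ = fun t =>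
      ![sinh (u t) * deriv u t * cos (v t) + cosh (u t) * (-sin (v t) * deriv v t),
        sinh (u t) * deriv u t * sin (v t) + cosh (u t) * (cos (v t) * deriv v t),
        cosh (u t) * deriv u t] := by
    funext t
    rw [show γ = fun t => Psi (u t) (v t) from funext hγ]
    refine HasDerivAt.deriv (hasDerivAt_pi.2 fun i => ?_)
    have hU := (hu0 t).hasDerivAt
    have hV := (hv0 t).hasDerivAt
    fin_cases i
    · exact hU.cosh.mul hV.cos
    · exact hU.cosh.mul hV.sin
    · exact hU.sinh
  have h2 : deriv (deriv γ) t =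
      ![((cosh (u t) * deriv u t) * deriv u t + sinh (u t) * deriv (deriv u) t) * cos (v t)
          + sinh (u t) * deriv u t * (-sin (v t) * deriv v t)
          + (sinh (u t) * deriv u t * (-sin (v t) * deriv v t)
            + cosh (u t) * (-(cos (v t) * deriv v t) * deriv v t
              + -sin (v t) * deriv (deriv v) t)),
        ((cosh (u t) * deriv u t) * deriv u t + sinh (u t) * deriv (deriv u) t) * sin (v t)
          + sinh (u t) * deriv u t * (cos (v t) * deriv v t)
          + (sinh (u t) * deriv u t * (cos (v t) * deriv v t)
            + cosh (u t) * ((-sin (v t) * deriv v t) * deriv v t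
              + cos (v t) * deriv (deriv v) t)),
        (sinh (u t) * deriv u t) * deriv u t + cosh (u t) * deriv (deriv u) t] := by
    rw [h1]
    refine HasDerivAt.deriv (hasDerivAt_pi.2 fun i => ?_)
    have hU := (hu0 t).hasDerivAt
    have hV := (hv0 t).hasDerivAt
    have hU1 := (hu1 t).hasDerivAt
    have hV1 := (hv1 t).hasDerivAt
    fin_cases i
    · exact ((hU.sinh.mul hU1).mul hV.cos).add
        (hU.cosh.mul (((hV.sin.neg).congr_deriv (by ring)).mul hV1))
    · exact ((hU.sinh.mul hU1).mul hV.sin).add (hU.cosh.mul (hV.cos.mul hV1))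
    · exact hU.cosh.mul hU1
  rw [h2, h1, hγ]
  simp only [det3, Psi, curvatureDet, Matrix.cons_val_zero, Matrix.cons_val_one, Matrix.cons_val]
  have hc := cosh_sq (u t)
  have ht := sin_sq (v t)
  generalize cosh (u t) = C at *
  generalize sinh (u t) = S at *
  generalize cos (v t) = c at *
  generalize sin (v t) = s at *
  grind

/-- The derivative at `s` of the integrand of the varied energy. -/
def variationIntegrand (ε lam : ℝ) (u v φ ψ : ℝ → ℝ) (s t : ℝ) : ℝ :=
  φ t * √(speedSq ε (u t + s * φ t) (deriv u t + s * deriv φ t) (deriv v t + s * deriv ψ t)) +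
    (u t + s * φ t + lam) *
      (ε * ((deriv v t + s * deriv ψ t) * deriv ψ t * cosh (u t + s * φ t) ^ 2
        + (deriv v t + s * deriv ψ t) ^ 2 * cosh (u t + s * φ t) * sinh (u t + s * φ t) * φ t
        - (deriv u t + s * deriv φ t) * deriv φ t)
      / √(speedSq ε (u t + s * φ t) (deriv u t + s * deriv φ t) (deriv v t + s * deriv ψ t)))

theorem hasDerivAt_energy {ε lam a b : ℝ} (hab : a ≤ b) {u v φ ψ : ℝ → ℝ}
    (hu : ContDiff ℝ (⊤ : ℕ∞) u) (hv : ContDiff ℝ (⊤ : ℕ∞) v)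
    (hφ : ContDiff ℝ (⊤ : ℕ∞) φ) (hψ : ContDiff ℝ (⊤ : ℕ∞) ψ)
    (hnd : ∀ t ∈ Icc a b, 0 < speedSq ε (u t) (deriv u t) (deriv v t)) :
    HasDerivAt (fun s : ℝ => ∫ t in a..b, (u t + s * φ t + lam) *
        √(speedSq ε (u t + s * φ t) (deriv u t + s * deriv φ t) (deriv v t + s * deriv ψ t)))
      (∫ t in a..b, variationIntegrand ε lam u v φ ψ 0 t) 0 := by
  have hu1 := (contDiff_infty_iff_deriv.1 hu).2.continuous
  have hv1 := (contDiff_infty_iff_deriv.1 hv).2.continuous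
  have hφ1 := (contDiff_infty_iff_deriv.1 hφ).2.continuous
  have hψ1 := (contDiff_infty_iff_deriv.1 hψ).2.continuous
  replace hu := hu.continuous
  replace hv := hv.continuous
  replace hφ := hφ.continuous
  replace hψ := hψ.continuous
  have hR : Continuous fun z : ℝ × ℝ => speedSq ε (u z.2 + z.1 * φ z.2)
      (deriv u z.2 + z.1 * deriv φ z.2) (deriv v z.2 + z.1 * deriv ψ z.2) := by
    unfold speedSq; fun_prop
  have hpos : ∀ᶠ s in 𝓝 (0 : ℝ), ∀ t ∈ Icc a b, 0 < speedSq ε (u t + s * φ t)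
      (deriv u t + s * deriv φ t) (deriv v t + s * deriv ψ t) :=
    isCompact_Icc.eventually_forall_of_forall_eventually fun t ht =>
      hR.continuousAt.eventually (lt_mem_nhds (by simpa using hnd t ht))
  obtain ⟨δ, hδ, hball⟩ := Metric.nhds_basis_closedBall.eventually_iff.1 hpos
  refine hasDerivAt_integral_of_continuousOn hab hδ (fun s => ?_) ?_ fun s hs t ht => ?_
  · unfold speedSq; fun_prop
  · unfold variationIntegrand
    refine ContinuousOn.add (by fun_prop) (ContinuousOn.mul (by fun_prop)
      (ContinuousOn.div (by fun_prop) hR.sqrt.continuousOn fun z hz => ?_))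
    exact (sqrt_pos.2 (hball hz.1 z.2 hz.2)).ne'
  · have hne := hball hs t ht
    have hlin : ∀ c d : ℝ, HasDerivAt (fun s : ℝ => c + s * d) d s := fun c d => by
      simpa using ((hasDerivAt_id s).mul_const d).const_add c
    have hsq := (((((hlin (deriv v t) (deriv ψ t)).pow 2).mul
      ((hlin (u t) (φ t)).cosh.pow 2)).sub
        ((hlin (deriv u t) (deriv φ t)).pow 2)).const_mul ε).sqrt hne.ne'
    refine (((hlin (u t) (φ t)).add_const lam).mul hsq).congr_deriv ?_
    simp only [variationIntegrand, speedSq, Pi.pow_apply, Pi.mul_apply, Pi.sub_apply] at hne ⊢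
    have := sqrt_pos.2 hne
    field_simp
    ring

theorem integral_variationIntegrand {ε lam a b : ℝ} (hab : a ≤ b) (hε : ε = 1 ∨ ε = -1)
    {u v φ ψ : ℝ → ℝ}
    (hu : ContDiff ℝ (⊤ : ℕ∞) u) (hv : ContDiff ℝ (⊤ : ℕ∞) v)
    (hφ : ContDiff ℝ (⊤ : ℕ∞) φ) (hψ : ContDiff ℝ (⊤ : ℕ∞) ψ)
    (hφa : φ a = 0) (hφb : φ b = 0) (hψa : ψ a = 0) (hψb : ψ b = 0)
    (hnd : ∀ t ∈ Icc a b, 0 < speedSq ε (u t) (deriv u t) (deriv v t)) :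
    ∫ t in a..b, variationIntegrand ε lam u v φ ψ 0 t =
      ∫ t in a..b, ε * catenaryDefect ε lam (u t) (deriv u t) (deriv v t)
          (deriv (deriv u) t) (deriv (deriv v) t) * cosh (u t)
        * (deriv v t * φ t - deriv u t * ψ t)
        / √(speedSq ε (u t) (deriv u t) (deriv v t)) ^ 3 := by
  obtain ⟨hu0, hu'⟩ := contDiff_infty_iff_deriv.1 hu
  obtain ⟨hv0, hv'⟩ := contDiff_infty_iff_deriv.1 hv
  obtain ⟨hu1, hu''⟩ := contDiff_infty_iff_deriv.1 hu'
  obtain ⟨hv1, hv''⟩ := contDiff_infty_iff_deriv.1 hv'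
  obtain ⟨hφ0, hφ'⟩ := contDiff_infty_iff_deriv.1 hφ
  obtain ⟨hψ0, hψ'⟩ := contDiff_infty_iff_deriv.1 hψ
  have hcu := hu.continuous
  have hcu' := hu'.continuous
  have hcu'' := hu''.continuous
  have hcv' := hv'.continuous
  have hcv'' := hv''.continuous
  have hcφ := hφ.continuous
  have hcφ' := hφ'.continuous
  have hcψ := hψ.continuous
  have hcψ' := hψ'.continuous
  have hne : ∀ t ∈ Icc a b, √(speedSq ε (u t) (deriv u t) (deriv v t)) ≠ 0 :=
    fun t ht => (sqrt_pos.2 (hnd t ht)).ne'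
  have hcont : Continuous fun t => √(speedSq ε (u t) (deriv u t) (deriv v t)) := by
    unfold speedSq; fun_prop
  have hint1 : IntervalIntegrable (variationIntegrand ε lam u v φ ψ 0) volume a b := by
    refine ContinuousOn.intervalIntegrable_of_Icc hab ?_
    unfold variationIntegrand
    simp only [zero_mul, add_zero]
    exact ContinuousOn.add (by fun_prop) (ContinuousOn.mul (by fun_prop)
      (ContinuousOn.div (by fun_prop) hcont.continuousOn hne))
  have hint2 : IntervalIntegrable (fun t => ε * catenaryDefect ε lam (u t) (deriv u t) (deriv v t)
          (deriv (deriv u) t) (deriv (deriv v) t) * cosh (u t)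
        * (deriv v t * φ t - deriv u t * ψ t)
        / √(speedSq ε (u t) (deriv u t) (deriv v t)) ^ 3) volume a b := by
    refine ContinuousOn.intervalIntegrable_of_Icc hab ?_
    refine ContinuousOn.div ?_ (hcont.pow 3).continuousOn fun t ht => pow_ne_zero 3 (hne t ht)
    unfold catenaryDefect curvatureDet speedSq
    fun_prop
  rw [← sub_eq_zero, ← intervalIntegral.integral_sub hint1 hint2,
    intervalIntegral.integral_eq_sub_of_hasDerivAt
      (f := fun t => ε * (u t + lam) * (deriv v t * cosh (u t) ^ 2 * ψ t - deriv u t * φ t)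
        / √(speedSq ε (u t) (deriv u t) (deriv v t))) (fun t ht => ?_) (hint1.sub hint2)]
  · simp [hφa, hφb, hψa, hψb]
  rw [uIcc_of_le hab] at ht
  have hQ := hnd t ht
  have hU := (hu0 t).hasDerivAt
  have hU1 := (hu1 t).hasDerivAt
  have hV1 := (hv1 t).hasDerivAt
  have hF := ((((hV1.pow 2).mul (hU.cosh.pow 2)).sub (hU1.pow 2)).const_mul ε).sqrt hQ.ne'
  refine ((((hU.add_const lam).const_mul ε).mul
    (((hV1.mul (hU.cosh.pow 2)).mul (hψ0 t).hasDerivAt).sub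
      (hU1.mul (hφ0 t).hasDerivAt))).div hF (hne t ht)).congr_deriv ?_
  have hFpos := sqrt_pos.2 hQ
  have hFsq := sq_sqrt hQ.le
  simp only [variationIntegrand, catenaryDefect, curvatureDet, speedSq, zero_mul, add_zero,
    Pi.pow_apply, Pi.mul_apply, Pi.sub_apply] at hFpos hFsq ⊢
  generalize √(ε * (deriv v t ^ 2 * cosh (u t) ^ 2 - deriv u t ^ 2)) = F at *
  generalize cosh (u t) = C at *
  generalize sinh (u t) = S at *
  field_simp
  rcases hε with rfl | rfl <;> grind

theorem catenaryDefect_eq_zero_iff {ε lam u p q p' q' : ℝ} (hnd : 0 < speedSq ε u p q)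
    (hne : u + lam ≠ 0) :
    ε * curvatureDet u p q p' q' / √(speedSq ε u p q) ^ 3
        = -(q * cosh u) / ((u + lam) * √(speedSq ε u p q)) ↔
      catenaryDefect ε lam u p q p' q' = 0 := by
  have hF := sqrt_pos.2 hnd
  have hFsq := sq_sqrt hnd.le
  unfold catenaryDefect
  generalize √(speedSq ε u p q) = F at *
  rw [div_eq_div_iff (by positivity) (by positivity), ← hFsq]
  constructor
  · intro h
    have : F * (q * cosh u * F ^ 2 + (u + lam) * ε * curvatureDet u p q p' q') = 0 := by
      linear_combination h
    exact (mul_eq_zero.1 this).resolve_left hF.ne'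
  · intro h
    linear_combination F * h

/-- The fundamental lemma of the calculus of variations for the energy with density `u + lam`:
it suffices to test against the normal variation weighted by the defect itself. -/
theorem catenaryDefect_eq_zero_of_integral_eq_zero {ε lam a b : ℝ} (hab : a < b)
    (hε : ε = 1 ∨ ε = -1) {u v : ℝ → ℝ}
    (hu : ContDiff ℝ (⊤ : ℕ∞) u) (hv : ContDiff ℝ (⊤ : ℕ∞) v)
    (hnd : ∀ t ∈ Icc a b, 0 < speedSq ε (u t) (deriv u t) (deriv v t))
    (h : ∀ φ ψ : ℝ → ℝ, ContDiff ℝ (⊤ : ℕ∞) φ → ContDiff ℝ (⊤ : ℕ∞) ψ →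
      φ a = 0 → φ b = 0 → ψ a = 0 → ψ b = 0 →
      ∫ t in a..b, ε * catenaryDefect ε lam (u t) (deriv u t) (deriv v t)
          (deriv (deriv u) t) (deriv (deriv v) t) * cosh (u t)
        * (deriv v t * φ t - deriv u t * ψ t)
        / √(speedSq ε (u t) (deriv u t) (deriv v t)) ^ 3 = 0) :
    ∀ t ∈ Icc a b, catenaryDefect ε lam (u t) (deriv u t) (deriv v t)
      (deriv (deriv u) t) (deriv (deriv v) t) = 0 := by
  have hu1 := (contDiff_infty_iff_deriv.1 hu).2
  have hv1 := (contDiff_infty_iff_deriv.1 hv).2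
  have hu2 := (contDiff_infty_iff_deriv.1 hu1).2
  have hv2 := (contDiff_infty_iff_deriv.1 hv1).2
  set N : ℝ → ℝ := fun t => catenaryDefect ε lam (u t) (deriv u t) (deriv v t)
      (deriv (deriv u) t) (deriv (deriv v) t) with hN
  have hNs : ContDiff ℝ (⊤ : ℕ∞) N := by
    simp only [hN, catenaryDefect, curvatureDet, speedSq]
    fun_prop
  have hεsq : ε * ε = 1 := by rcases hε with rfl | rfl <;> norm_num
  have hFcont : Continuous fun t => √(speedSq ε (u t) (deriv u t) (deriv v t)) := by
    have := hu.continuous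
    have := hu1.continuous
    have := hv1.continuous
    unfold speedSq
    fun_prop
  have hF : ∀ t ∈ Icc a b, 0 < √(speedSq ε (u t) (deriv u t) (deriv v t)) :=
    fun t ht => sqrt_pos.2 (hnd t ht)
  have hzero : ∫ t in a..b, N t ^ 2 * cosh (u t) * (deriv v t ^ 2 + deriv u t ^ 2)
      * ((t - a) * (b - t)) / √(speedSq ε (u t) (deriv u t) (deriv v t)) ^ 3 = 0 := by
    rw [← h (fun t => ε * ((t - a) * (b - t)) * N t * deriv v t)
      (fun t => -(ε * ((t - a) * (b - t)) * N t * deriv u t))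
      (by fun_prop) (by fun_prop) (by simp) (by simp) (by simp) (by simp)]
    congr 1 with t
    congr 1
    linear_combination (-(N t ^ 2 * cosh (u t) * (deriv v t ^ 2 + deriv u t ^ 2)
      * ((t - a) * (b - t)))) * hεsq
  have hIoo : ∀ t ∈ Ioo a b, N t = 0 := by
    intro t ht
    by_contra hNt
    refine (intervalIntegral.integral_pos hab ?_ ?_ ⟨t, Ioo_subset_Icc_self ht, ?_⟩).ne' hzero
    · have := hu.continuous
      have := hu1.continuous
      have := hv1.continuous
      have := hNs.continuous
      exact ContinuousOn.div (by fun_prop) (hFcont.pow 3).continuousOn fun s hs => (pow_pos (hF s hs) 3).ne'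
    · intro s hs
      have h1 : 0 ≤ s - a := sub_nonneg.2 hs.1.le
      have h2 : 0 ≤ b - s := sub_nonneg.2 hs.2
      have h3 := cosh_pos (u s)
      positivity
    · have h1 : 0 < t - a := sub_pos.2 ht.1
      have h2 : 0 < b - t := sub_pos.2 ht.2
      have h3 := cosh_pos (u t)
      have h4 := hF t (Ioo_subset_Icc_self ht)
      have h5 : 0 < deriv v t ^ 2 + deriv u t ^ 2 := by
        by_contra! hle
        have hv0 : deriv v t = 0 := by nlinarith [sq_nonneg (deriv v t), sq_nonneg (deriv u t)]
        have hu0 : deriv u t = 0 := by nlinarith [sq_nonneg (deriv v t), sq_nonneg (deriv u t)]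
        simp [speedSq, hv0, hu0] at h4
      positivity
  intro t ht
  rw [← closure_Ioo hab.ne] at ht
  exact closure_minimal (t := {t | N t = 0}) hIoo
    (isClosed_eq hNs.continuous continuous_const) ht

theorem isCritical_iff_catenaryDefect_eq_zero {ε lam a b : ℝ} (hab : a < b)
    (hε : ε = 1 ∨ ε = -1) {u v : ℝ → ℝ}
    (hu : ContDiff ℝ (⊤ : ℕ∞) u) (hv : ContDiff ℝ (⊤ : ℕ∞) v)
    (hnd : ∀ t ∈ Icc a b, 0 < speedSq ε (u t) (deriv u t) (deriv v t)) :
    IsCritical (fun x _ => x + lam) ε u v a b ↔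
      ∀ t ∈ Icc a b, catenaryDefect ε lam (u t) (deriv u t) (deriv v t)
        (deriv (deriv u) t) (deriv (deriv v) t) = 0 := by
  constructor
  · intro h
    refine catenaryDefect_eq_zero_of_integral_eq_zero hab hε hu hv hnd
      fun φ ψ hφ hψ hφa hφb hψa hψb => ?_
    rw [← integral_variationIntegrand hab.le hε hu hv hφ hψ hφa hφb hψa hψb hnd,
      ← (hasDerivAt_energy hab.le hu hv hφ hψ hnd).deriv]
    exact h φ ψ hφ hψ hφa hφb hψa hψb
  · intro h φ ψ hφ hψ hφa hφb hψa hψb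
    refine (hasDerivAt_energy hab.le hu hv hφ hψ hnd).deriv.trans ?_
    rw [integral_variationIntegrand hab.le hε hu hv hφ hψ hφa hφb hψa hψb hnd]
    refine intervalIntegral.integral_zero_ae (ae_of_all _ fun t ht => ?_)
    rw [uIoc_of_le hab.le] at ht
    simp [h t (Ioc_subset_Icc_self ht)]

theorem intrinsic_catenary_characterization
    (a b lam : ℝ) (hab : a < b)
    (u v : ℝ → ℝ) (hu : ContDiff ℝ (⊤ : ℕ∞) u) (hv : ContDiff ℝ (⊤ : ℕ∞) v)
    (ε : ℝ) (hε : ε = 1 ∨ ε = -1)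
    (γ : ℝ → Fin 3 → ℝ) (hγ : ∀ t, γ t = Psi (u t) (v t))
    (sp : ℝ → ℝ)
    (hsp : ∀ t, sp t =
      Real.sqrt (ε * ((deriv v t) ^ 2 * Real.cosh (u t) ^ 2 - (deriv u t) ^ 2)))
    (hnd : ∀ t ∈ Set.Icc a b,
      0 < ε * ((deriv v t) ^ 2 * Real.cosh (u t) ^ 2 - (deriv u t) ^ 2))
    (κ : ℝ → ℝ)
    (hκ : ∀ t, κ t = ε * det3 (γ t) (deriv γ t) (deriv (deriv γ) t) / sp t ^ 3)
    (hd : ∀ t ∈ Set.Icc a b, 0 < u t)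
    (hne : ∀ t ∈ Set.Icc a b, u t + lam ≠ 0) :
    IsCritical (fun x _ => x + lam) ε u v a b ↔
      ∀ t ∈ Set.Icc a b,
        κ t = -(deriv v t * Real.cosh (u t)) / ((u t + lam) * sp t) := by
  rw [isCritical_iff_catenaryDefect_eq_zero hab hε hu hv hnd]
  refine forall₂_congr fun t ht => ?_
  rw [hκ, det3_Psi hu hv hγ, hsp]
  exact (catenaryDefect_eq_zero_iff (hnd t ht) (hne t ht)).symm
end
end

section
/- Let γ(t) = Ψ(u(t), v(t)) be a nondegenerate curve in S₁² with principal normal n(t), and let V(Ψ(u,v)) = (sinh(u) cos(v), sinh(u) sin(v), cosh(u)). Then ⟨n(t), V(γ(t))⟩ = − v'(t) cosh(u(t)) / |γ'(t)| for all t. -/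
noncomputable section

open Real

/-- Lorentzian cross product, characterized by `lprod (lcross a b) c = det3 a b c`. -/
def lcross (a b : Fin 3 → ℝ) : Fin 3 → ℝ :=
  ![a 1 * b 2 - a 2 * b 1, a 2 * b 0 - a 0 * b 2, a 1 * b 0 - a 0 * b 1]

/-- Velocity of a curve on the de Sitter plane in the coordinates of `Psi`. -/
theorem hasDerivAt_Psi {u v : ℝ → ℝ} {u' v' t : ℝ}
    (hu : HasDerivAt u u' t) (hv : HasDerivAt v v' t) :
    HasDerivAt (fun s => Psi (u s) (v s))
      ![Real.sinh (u t) * u' * Real.cos (v t) + Real.cosh (u t) * (-Real.sin (v t) * v'),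
        Real.sinh (u t) * u' * Real.sin (v t) + Real.cosh (u t) * (Real.cos (v t) * v'),
        Real.cosh (u t) * u'] t := by
  rw [hasDerivAt_pi]
  intro i
  fin_cases i
  · exact hu.cosh.mul hv.cos
  · exact hu.cosh.mul hv.sin
  · exact hu.sinh

theorem normal_inner_V
    (u v : ℝ → ℝ) (hu : ContDiff ℝ (⊤ : ℕ∞) u) (hv : ContDiff ℝ (⊤ : ℕ∞) v)
    (ε : ℝ) (hε : ε = 1 ∨ ε = -1)
    (γ : ℝ → Fin 3 → ℝ) (hγ : ∀ t, γ t = Psi (u t) (v t))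
    (sp : ℝ → ℝ)
    (hsp : ∀ t, sp t =
      Real.sqrt (ε * ((deriv v t) ^ 2 * Real.cosh (u t) ^ 2 - (deriv u t) ^ 2)))
    (hnd : ∀ t, 0 < ε * ((deriv v t) ^ 2 * Real.cosh (u t) ^ 2 - (deriv u t) ^ 2))
    (n : ℝ → Fin 3 → ℝ) (hn : ∀ t, n t = (-(1 / sp t)) • lcross (γ t) (deriv γ t))
    :
    ∀ t, lprod (n t) ![Real.sinh (u t) * Real.cos (v t),
        Real.sinh (u t) * Real.sin (v t), Real.cosh (u t)]
      = -(deriv v t * Real.cosh (u t)) / sp t := by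
  intro t
  have hγ' := hasDerivAt_Psi
    ((hu.differentiable (by simp)) t).hasDerivAt ((hv.differentiable (by simp)) t).hasDerivAt
  rw [hn t, funext hγ, hγ'.deriv]
  have h1 := Real.cosh_sq (u t)
  have h2 := Real.sin_sq_add_cos_sq (v t)
  simp only [lprod, lcross, Psi, Pi.smul_apply, smul_eq_mul, Matrix.cons_val]
  generalize Real.cosh (u t) = c at *
  generalize Real.sinh (u t) = s at *
  generalize Real.sin (v t) = y at *
  generalize Real.cos (v t) = x at *
  linear_combination (-(1 / sp t)) * (deriv v t * c * (x ^ 2 + y ^ 2)) * h1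
    + (-(1 / sp t)) * (deriv v t * c) * h2
end
end
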